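/- For any positive integers n and k with 2 ≤ k ≤ n−2 and any α ∈ ℕ, the polyhedron Q*(C_n^k, α·1) is completely described by the inequalities x ≥ 0 and C_n^k x ≥ α·1, the rank constraint Σ_{j} x_j ≥ τ_{α·1}(C_n^k), and the Γ-inequalities over all simple directed circuits Γ in F(C_n^k) containing no forward short arcs. -/

import Mathlib

namespace CircCover

attribute [local instance] Classical.propDecidable

/-- Membership in the circular interval `[a, a + k)ₙ` of `ZMod n`. -/
def inInterval {n : ℕ} (a : ZMod n) (k : ℕ) (j : ZMod n) : Prop :=
  ∃ s : ℕ, s < k ∧ j = a + (s : ZMod n)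

/-- The `{0,1}`-matrix whose `i`-th row is the incidence vector of `[ℓ i, ℓ i + k i)ₙ`. -/
noncomputable def circMatrix {m n : ℕ} (ℓ : Fin m → ZMod n) (k : Fin m → ℕ) :
    Matrix (Fin m) (ZMod n) ℝ :=
  fun i j => if inInterval (ℓ i) (k i) j then 1 else 0

/-- The condition `2 ≤ kᵢ ≤ n - 1` making `circMatrix ℓ k` a circular matrix. -/
def circBounds (n : ℕ) {m : ℕ} (k : Fin m → ℕ) : Prop :=
  ∀ i, 2 ≤ k i ∧ k i ≤ n - 1

/-- Arcs of the digraph `D(A)` associated with a circular matrix. -/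
inductive Arc (m n : ℕ) : Type
  | fwdRow (i : Fin m)
  | fwdShort (j : ZMod n)
  | revRow (i : Fin m)
  | revShort (j : ZMod n)
  deriving DecidableEq

namespace Arc

variable {m n : ℕ} (ℓ : Fin m → ZMod n) (k : Fin m → ℕ)

/-- The tail of an arc of `D(A)`. -/
def tail : Arc m n → ZMod n
  | fwdRow i => ℓ i - 1
  | fwdShort j => j - 1
  | revRow i => ℓ i + (k i : ZMod n) - 1
  | revShort j => j

/-- The head of an arc of `D(A)`. -/
def head : Arc m n → ZMod n
  | fwdRow i => ℓ i + (k i : ZMod n) - 1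
  | fwdShort j => j
  | revRow i => ℓ i - 1
  | revShort j => j - 1

/-- The oriented length of an arc of `D(A)`. -/
def len (k : Fin m → ℕ) : Arc m n → ℤ
  | fwdRow i => (k i : ℤ)
  | fwdShort _ => 1
  | revRow i => -(k i : ℤ)
  | revShort _ => -1

/-- Forward arcs. -/
def IsForward : Arc m n → Prop
  | fwdRow _ => True
  | fwdShort _ => True
  | _ => False

/-- Forward row arcs. -/
def IsFwdRow : Arc m n → Prop
  | fwdRow _ => True
  | _ => False

/-- Reverse row arcs. -/
def IsRevRow : Arc m n → Prop
  | revRow _ => True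
  | _ => False

/-- Forward short arcs. -/
def IsFwdShort : Arc m n → Prop
  | fwdShort _ => True
  | _ => False

/-- The arc jumps over node `j`. -/
def Jumps : Arc m n → ZMod n → Prop
  | fwdRow i, j => inInterval (ℓ i) (k i) j
  | fwdShort j', j => j' = j
  | revRow i, j => inInterval (ℓ i) (k i) j
  | revShort j', j => j' = j

end Arc

variable {m n : ℕ}

/-- A (not necessarily simple) closed directed path in `D(A)`, given as its list of arcs. -/
def IsClosedWalk (ℓ : Fin m → ZMod n) (k : Fin m → ℕ) (γ : List (Arc m n)) : Prop :=
  ∃ h : γ ≠ [],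
    List.Chain' (fun a b => Arc.head ℓ k a = Arc.tail ℓ k b) γ ∧
      Arc.head ℓ k (γ.getLast h) = Arc.tail ℓ k (γ.head h)

/-- A simple directed circuit in `D(A)`: a closed directed path visiting pairwise
distinct nodes. -/
def IsCircuit (ℓ : Fin m → ZMod n) (k : Fin m → ℕ) (γ : List (Arc m n)) : Prop :=
  IsClosedWalk ℓ k γ ∧ (γ.map (Arc.tail ℓ k)).Nodup

/-- The sum of the oriented lengths of the arcs of `γ`; it equals `p(γ) * n` where `p(γ)`
is the winding number. -/
def windingSum (k : Fin m → ℕ) (γ : List (Arc m n)) : ℤ :=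
  (γ.map (Arc.len k)).sum

/-- `p⁺(γ, j)`: the number of forward arcs of `γ` jumping over `j`. -/
noncomputable def pPlus (ℓ : Fin m → ZMod n) (k : Fin m → ℕ) (γ : List (Arc m n))
    (j : ZMod n) : ℕ :=
  γ.countP fun a => decide (Arc.IsForward a ∧ Arc.Jumps ℓ k a j)

/-- `p⁻(γ, j)`: the number of reverse arcs of `γ` jumping over `j`. -/
noncomputable def pMinus (ℓ : Fin m → ZMod n) (k : Fin m → ℕ) (γ : List (Arc m n))
    (j : ZMod n) : ℕ :=
  γ.countP fun a => decide (¬ Arc.IsForward a ∧ Arc.Jumps ℓ k a j)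

/-- The number of (forward) row arcs of `γ` jumping over `j`. -/
noncomputable def rowJumpCount (ℓ : Fin m → ZMod n) (k : Fin m → ℕ) (γ : List (Arc m n))
    (j : ZMod n) : ℕ :=
  γ.countP fun a => decide (Arc.IsFwdRow a ∧ Arc.Jumps ℓ k a j)

/-- The number of forward row arcs of `γ`. -/
def numRowArcs (γ : List (Arc m n)) : ℕ :=
  γ.countP fun a => match a with | Arc.fwdRow _ => true | _ => false

/-- `t(γ, b) = ∑_{aᵢ ∈ γ} bᵢ - ∑_{āᵢ ∈ γ} bᵢ`. -/
def tVal (b : Fin m → ℤ) (γ : List (Arc m n)) : ℤ :=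
  (γ.map fun a => match a with
    | Arc.fwdRow i => b i
    | Arc.revRow i => -(b i)
    | _ => 0).sum

/-- `t⁻(γ, b) = ∑_{āᵢ ∈ γ} bᵢ`. -/
def tMinusVal (b : Fin m → ℤ) (γ : List (Arc m n)) : ℤ :=
  (γ.map fun a => match a with
    | Arc.revRow i => b i
    | _ => 0).sum

/-- `β(γ, b) = ⌊t(γ, b) / p⌋`. -/
def betaVal (b : Fin m → ℤ) (γ : List (Arc m n)) (p : ℤ) : ℤ :=
  Int.fdiv (tVal b γ) p

/-- `r(γ, b) = t(γ, b) - β(γ, b) * p`. -/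
def rVal (b : Fin m → ℤ) (γ : List (Arc m n)) (p : ℤ) : ℤ :=
  tVal b γ - betaVal b γ p * p

/-- The `γ`-inequality `∑ⱼ (p⁻(γ,j) + r) xⱼ ≥ r (β + 1) + ∑_{āᵢ ∈ γ} bᵢ`. -/
def GammaIneqHolds [NeZero n] (ℓ : Fin m → ZMod n) (k : Fin m → ℕ) (b : Fin m → ℤ)
    (γ : List (Arc m n)) (p : ℤ) (x : ZMod n → ℝ) : Prop :=
  ∑ j : ZMod n, ((pMinus ℓ k γ j : ℝ) + (rVal b γ p : ℝ)) * x j ≥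
    (rVal b γ p : ℝ) * ((betaVal b γ p : ℝ) + 1) + (tMinusVal b γ : ℝ)

/-- The fractional covering polyhedron `Q(A, b) = {x ≥ 0 : A x ≥ b}`. -/
def Qpoly [NeZero n] (A : Matrix (Fin m) (ZMod n) ℝ) (b : Fin m → ℝ) :
    Set (ZMod n → ℝ) :=
  {x | (∀ j, 0 ≤ x j) ∧ ∀ i, b i ≤ ∑ j : ZMod n, A i j * x j}

/-- A point of `ℝⁿ` all whose coordinates are integers. -/
def IsIntegerPoint {n : ℕ} (x : ZMod n → ℝ) : Prop :=
  ∀ j, ∃ z : ℤ, x j = (z : ℝ)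

/-- The covering polyhedron `Q*(A, b) = conv{x ∈ ℤⁿ : x ≥ 0, A x ≥ b}`. -/
noncomputable def Qstar [NeZero n] (A : Matrix (Fin m) (ZMod n) ℝ) (b : Fin m → ℝ) :
    Set (ZMod n → ℝ) :=
  convexHull ℝ {x | IsIntegerPoint x ∧ x ∈ Qpoly A b}

/-- The slack of row `i` of `A` at the point `x`. -/
noncomputable def rowSlack [NeZero n] (ℓ : Fin m → ZMod n) (k : Fin m → ℕ)
    (b : Fin m → ℤ) (x : ZMod n → ℝ) (i : Fin m) : ℝ :=
  (∑ j : ZMod n, circMatrix ℓ k i j * x j) - (b i : ℝ)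

/-- `μ = ⌈1ᵀ x⌉ - 1ᵀ x`. -/
noncomputable def muVal [NeZero n] (x : ZMod n → ℝ) : ℝ :=
  (⌈∑ j : ZMod n, x j⌉ : ℝ) - ∑ j : ZMod n, x j

/-- Entry `i` of the last column `v` of `Ã` (the column indexed by `n ≡ 0`). -/
noncomputable def vRow (ℓ : Fin m → ZMod n) (k : Fin m → ℕ) (i : Fin m) : ℝ :=
  circMatrix ℓ k i 0

/-- Entry `m + j` of the last column `v` of `Ã`. -/
noncomputable def vShort (j : ZMod n) : ℝ :=
  if j = 0 then 1 else 0

/-- The cost of an arc in the weighted digraph `D(A, x)`: forward arcs carry the cost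
`c⁺ = μ (s* - (1 - μ) v)` and reverse arcs the cost `c⁻ = (1 - μ)(s* + μ v)`. -/
noncomputable def arcCost [NeZero n] (ℓ : Fin m → ZMod n) (k : Fin m → ℕ)
    (b : Fin m → ℤ) (x : ZMod n → ℝ) : Arc m n → ℝ
  | Arc.fwdRow i => muVal x * (rowSlack ℓ k b x i - (1 - muVal x) * vRow ℓ k i)
  | Arc.fwdShort j => muVal x * (x j - (1 - muVal x) * vShort j)
  | Arc.revRow i => (1 - muVal x) * (rowSlack ℓ k b x i + muVal x * vRow ℓ k i)
  | Arc.revShort j => (1 - muVal x) * (x j + muVal x * vShort j)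

/-- The cost `c(γ, x)` of a walk `γ` in `D(A, x)`. -/
noncomputable def walkCost [NeZero n] (ℓ : Fin m → ZMod n) (k : Fin m → ℕ)
    (b : Fin m → ℤ) (x : ZMod n → ℝ) (γ : List (Arc m n)) : ℝ :=
  (γ.map (arcCost ℓ k b x)).sum

/-- Row `i` dominates row `i'` of `A`. -/
def Dominates (A : Matrix (Fin m) (ZMod n) ℝ) (i i' : Fin m) : Prop :=
  i ≠ i' ∧ ∀ j, A i' j ≤ A i j

/-- `A` has no dominating rows. -/
def NoDominatingRows (A : Matrix (Fin m) (ZMod n) ℝ) : Prop :=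
  ∀ i i', ¬ Dominates A i i'

/-- The affine dimension of a subset of `ℝⁿ` (`-1` for the empty set). -/
noncomputable def adim [NeZero n] (S : Set (ZMod n → ℝ)) : ℤ :=
  if S = ∅ then -1 else (Module.finrank ℝ (affineSpan ℝ S).direction : ℤ)

/-- The valid inequality `aᵀ x ≥ α₀` defines a facet of `P`:
the face it defines has affine dimension `dim P - 1`. -/
def IsFacetIneq [NeZero n] (P : Set (ZMod n → ℝ)) (a : ZMod n → ℝ) (α₀ : ℝ) : Prop :=
  (∀ x ∈ P, α₀ ≤ ∑ j : ZMod n, a j * x j) ∧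
    adim {x ∈ P | ∑ j : ZMod n, a j * x j = α₀} = adim P - 1

/-- `j` is a node of the walk `γ`. -/
def IsNodeOf (ℓ : Fin m → ZMod n) (k : Fin m → ℕ) (γ : List (Arc m n)) (j : ZMod n) : Prop :=
  ∃ a ∈ γ, Arc.tail ℓ k a = j

/-- `j` is an essential bullet of `γ`: a node of `γ` which is neither a circle
(head of a forward short arc of `γ`) nor a cross (tail of a reverse short arc of `γ`). -/
def IsEssentialBullet (ℓ : Fin m → ZMod n) (k : Fin m → ℕ) (γ : List (Arc m n))
    (j : ZMod n) : Prop :=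
  IsNodeOf ℓ k γ j ∧ Arc.fwdShort j ∉ γ ∧ Arc.revShort j ∉ γ

/-- The number of essential bullets of `γ`. -/
noncomputable def numEssentialBullets [NeZero n] (ℓ : Fin m → ZMod n) (k : Fin m → ℕ)
    (γ : List (Arc m n)) : ℕ :=
  (Finset.univ.filter fun j : ZMod n => IsEssentialBullet ℓ k γ j).card

/-- `∑_{i ∈ F} a_{ij}`, the number of rows of `F` whose interval contains `j`. -/
noncomputable def rowCount (ℓ : Fin m → ZMod n) (k : Fin m → ℕ) (F : Finset (Fin m))
    (j : ZMod n) : ℕ :=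
  (F.filter fun i => inInterval (ℓ i) (k i) j).card

/-- The row family inequality induced by `F` (with `p* = max_j ∑_{i ∈ F} a_{ij} - 1`). -/
def RowFamilyIneqHolds [NeZero n] (ℓ : Fin m → ZMod n) (k : Fin m → ℕ)
    (F : Finset (Fin m)) (x : ZMod n → ℝ) : Prop :=
  let s := F.card
  let pstar := (Finset.univ.sup fun j : ZMod n => rowCount ℓ k F j) - 1
  let rstar := s - pstar * (s / pstar)
  ((rstar : ℝ) + 1) * ∑ j ∈ Finset.univ.filter (fun j : ZMod n => rowCount ℓ k F j = pstar + 1), x j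
    + (rstar : ℝ) * ∑ j ∈ Finset.univ.filter (fun j : ZMod n => rowCount ℓ k F j ≤ pstar), x j
    ≥ (rstar : ℝ) * (((s + pstar - 1) / pstar : ℕ) : ℝ)

open Finset

/-- The sum of `y` over the circular interval `[u, u + k)ₙ`. -/
def windowSum (k : ℕ) (y : ZMod n → ℝ) (u : ZMod n) : ℝ :=
  ∑ s ∈ range k, y (u + (s : ZMod n))

lemma windowSum_add_one (k : ℕ) (y : ZMod n → ℝ) (u : ZMod n) :
    windowSum k y (u + 1) + y u = windowSum k y u + y (u + (k : ZMod n)) := by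
  unfold windowSum
  rw [← sum_range_succ (fun s : ℕ => y (u + (s : ZMod n))), sum_range_succ']
  simp [add_assoc, add_comm (1 : ZMod n)]

lemma windowSum_add (k : ℕ) (y z : ZMod n → ℝ) (u : ZMod n) :
    windowSum k (y + z) u = windowSum k y u + windowSum k z u := by
  simp [windowSum, sum_add_distrib]

lemma windowSum_sub (k : ℕ) (y z : ZMod n → ℝ) (u : ZMod n) :
    windowSum k (y - z) u = windowSum k y u - windowSum k z u := by
  simp [windowSum, sum_sub_distrib]

lemma windowSum_smul (k : ℕ) (c : ℝ) (y : ZMod n → ℝ) (u : ZMod n) :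
    windowSum k (c • y) u = c * windowSum k y u := by
  simp [windowSum, mul_sum]

lemma windowSum_mono (k : ℕ) {y z : ZMod n → ℝ} (h : y ≤ z) (u : ZMod n) :
    windowSum k y u ≤ windowSum k z u :=
  sum_le_sum fun _ _ => h _

lemma windowSum_nonneg (k : ℕ) {y : ZMod n → ℝ} (h : 0 ≤ y) (u : ZMod n) :
    0 ≤ windowSum k y u :=
  sum_nonneg fun _ _ => h _

lemma continuous_windowSum (k : ℕ) (u : ZMod n) :
    Continuous fun y : ZMod n → ℝ => windowSum k y u := by
  unfold windowSum
  fun_prop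

lemma natCast_injOn_range [NeZero n] {k : ℕ} (hk : k ≤ n) :
    Set.InjOn (fun s : ℕ => (s : ZMod n)) (range k) := by
  intro s hs t ht h
  simp only [coe_range, Set.mem_Iio] at hs ht
  have := congrArg ZMod.val h
  simpa [ZMod.val_natCast, Nat.mod_eq_of_lt (hs.trans_le hk),
    Nat.mod_eq_of_lt (ht.trans_le hk)] using this

lemma sum_inInterval_mul [NeZero n] {k : ℕ} (hk : k ≤ n) (u : ZMod n) (y : ZMod n → ℝ) :
    ∑ j : ZMod n, (if inInterval u k j then (1 : ℝ) else 0) * y j = windowSum k y u := by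
  have himg : (univ.filter fun j : ZMod n => inInterval u k j) =
      (range k).image fun s : ℕ => u + (s : ZMod n) := by
    ext j
    rw [mem_filter, mem_image]
    simp only [mem_univ, true_and, mem_range]
    exact exists_congr fun s => and_congr_right fun _ => eq_comm
  simp only [ite_mul, one_mul, zero_mul]
  rw [← sum_filter, himg, sum_image, windowSum]
  intro s hs t ht h
  exact natCast_injOn_range hk hs ht (add_left_cancel h)

lemma windowSum_self [NeZero n] (y : ZMod n → ℝ) (u : ZMod n) :
    windowSum n y u = ∑ j, y j := by
  rw [← sum_inInterval_mul le_rfl]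
  refine sum_congr rfl fun j _ => ?_
  rw [if_pos, one_mul]
  exact ⟨(j - u).val, ZMod.val_lt _, by simp⟩

lemma windowSum_le_sum [NeZero n] {k : ℕ} (hk : k ≤ n) {y : ZMod n → ℝ} (h : 0 ≤ y)
    (u : ZMod n) : windowSum k y u ≤ ∑ j, y j := by
  rw [← windowSum_self y u]
  exact sum_le_sum_of_subset_of_nonneg (by simpa using hk) fun _ _ _ => h _

lemma mem_Qpoly_iff [NeZero n] {k : ℕ} (hk : k ≤ n) (c : ℝ) (y : ZMod n → ℝ) :
    y ∈ Qpoly (circMatrix (fun i : Fin n => ((i : ℕ) : ZMod n)) (fun _ => k)) (fun _ => c) ↔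
      0 ≤ y ∧ ∀ u, c ≤ windowSum k y u := by
  simp only [Qpoly, circMatrix, Set.mem_ofPred_eq, sum_inInterval_mul hk]
  refine and_congr Iff.rfl ⟨fun h u => ?_, fun h i => h _⟩
  simpa using h ⟨u.val, ZMod.val_lt u⟩

lemma sum_windowSum_orbit [NeZero n] (k : ℕ) (y : ZMod n → ℝ) (u : ZMod n) :
    ∑ i ∈ range n, windowSum k y (u + (i : ZMod n) * (k : ZMod n)) = k * ∑ j, y j := by
  unfold windowSum
  have h1 : ∀ N : ℕ, ∑ i ∈ range N, ∑ s ∈ range k,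
      y (u + (i : ZMod n) * (k : ZMod n) + (s : ZMod n)) =
        ∑ t ∈ range (N * k), y (u + (t : ZMod n)) := by
    intro N
    induction N with
    | zero => simp
    | succ N ih =>
      rw [sum_range_succ, ih, Nat.succ_mul, sum_range_add]
      simp [add_assoc]
  have h2 : ∀ N : ℕ, ∑ t ∈ range (n * N), y (u + (t : ZMod n)) = N * ∑ j, y j := by
    intro N
    induction N with
    | zero => simp
    | succ N ih =>
      rw [Nat.mul_succ, sum_range_add, ih, ← windowSum_self y u, windowSum]
      push_cast
      simp only [ZMod.natCast_self, zero_mul, zero_add]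
      ring
  rw [h1, h2]

/-- A quasi-periodic primitive of `y` on the universal cover `ℤ` of `ZMod n`. -/
lemma exists_primitive [NeZero n] (y : ZMod n → ℝ) :
    ∃ Y : ℤ → ℝ, (∀ t : ℤ, ∀ k : ℕ, windowSum k y (t : ZMod n) = Y (t + k) - Y t) ∧
      ∀ t p : ℤ, Y (t + p * n) = Y t + p * ∑ j, y j := by
  have hstep : ∃ Y : ℤ → ℝ, ∀ t : ℤ, Y (t + 1) = Y t + y (t : ZMod n) := by
    refine ⟨fun t => ∑ s ∈ Ico 0 t, y (s : ZMod n) - ∑ s ∈ Ico t 0, y (s : ZMod n),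
      fun t => ?_⟩
    rcases le_or_gt 0 t with ht | ht
    · have h : Ico 0 (t + 1) = insert t (Ico 0 t) := by ext s; simp; omega
      have h1 : Ico (t + 1) 0 = ∅ := by ext s; simp; omega
      have h2 : Ico t 0 = ∅ := by ext s; simp; omega
      simp only [h, h1, h2, sum_empty]
      rw [sum_insert (by simp)]
      ring
    · have h : Ico t 0 = insert t (Ico (t + 1) 0) := by ext s; simp; omega
      have h1 : Ico 0 (t + 1) = ∅ := by ext s; simp; omega
      have h2 : Ico 0 t = ∅ := by ext s; simp; omega
      simp only [h, h1, h2, sum_empty]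
      rw [sum_insert (by simp)]
      ring
  obtain ⟨Y, hY⟩ := hstep
  have hwin : ∀ t : ℤ, ∀ k : ℕ, windowSum k y (t : ZMod n) = Y (t + k) - Y t := by
    intro t k
    induction k with
    | zero => simp [windowSum]
    | succ k ih =>
      have h := hY (t + k)
      rw [windowSum, sum_range_succ, ← windowSum, ih]
      push_cast at h ⊢
      rw [← add_assoc, h]
      ring
  have hper : ∀ t : ℤ, Y (t + n) = Y t + ∑ j, y j := by
    intro t
    have := hwin t n
    rw [windowSum_self] at this
    linarith
  refine ⟨Y, hwin, fun t p => ?_⟩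
  induction p using Int.induction_on generalizing t with
  | zero => simp
  | succ i ih =>
    have := hper (t + i * n)
    rw [ih] at this
    rw [add_mul, one_mul, ← add_assoc, this]
    push_cast
    ring
  | pred i ih =>
    have := hper (t + (-i - 1) * n)
    have h := ih t
    rw [show t + (-(i : ℤ) - 1) * n + n = t + -i * n by ring, h] at this
    push_cast at this ⊢
    linarith

/-- The signed sum of `y` over the nodes an arc of `D(Cₙᵏ)` jumps over. -/
def arcValue (k : ℕ) (y : ZMod n → ℝ) : Arc n n → ℝ
  | Arc.fwdRow i => windowSum k y ((i : ℕ) : ZMod n)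
  | Arc.fwdShort j => y j
  | Arc.revRow i => -windowSum k y ((i : ℕ) : ZMod n)
  | Arc.revShort j => -y j

/-- The slack of the constraint that an arc of `F(Cₙᵏ)` imposes on a vector `y`:
`y ≥ c` on row windows, and `y ≤ x` on single nodes. -/
def arcSlack (k : ℕ) (c : ℝ) (x y : ZMod n → ℝ) : Arc n n → ℝ
  | Arc.fwdRow i => windowSum k y ((i : ℕ) : ZMod n) - c
  | Arc.revShort j => x j - y j
  | _ => 0

lemma sum_arcValue [NeZero n] {k : ℕ} (y : ZMod n → ℝ) {γ : List (Arc n n)} {p : ℤ}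
    (hγ : γ.IsChain fun a b =>
      Arc.head (fun i : Fin n => ((i : ℕ) : ZMod n)) (fun _ => k) a =
        Arc.tail (fun i : Fin n => ((i : ℕ) : ZMod n)) (fun _ => k) b)
    (hp : p * (n : ℤ) = windingSum (fun _ : Fin n => k) γ) :
    (γ.map (arcValue k y)).sum = p * ∑ j, y j := by
  obtain ⟨Y, hwin, hper⟩ := exists_primitive y
  have hone : ∀ t : ℤ, y (t : ZMod n) = Y (t + 1) - Y t := fun t => by
    simpa [windowSum] using hwin t 1
  have harc : ∀ (a : Arc n n) (t : ℤ),
      (t : ZMod n) = Arc.tail (fun i : Fin n => ((i : ℕ) : ZMod n)) (fun _ => k) a + 1 →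
      arcValue k y a = Y (t + Arc.len (fun _ => k) a) - Y t ∧
      ((t + Arc.len (fun _ => k) a : ℤ) : ZMod n) =
        Arc.head (fun i : Fin n => ((i : ℕ) : ZMod n)) (fun _ => k) a + 1 := by
    intro a t ht
    cases a with
    | fwdRow i =>
      simp only [Arc.tail, sub_add_cancel] at ht
      simp [arcValue, Arc.len, Arc.head, ← ht, hwin]
    | fwdShort j =>
      simp only [Arc.tail, sub_add_cancel] at ht
      simp [arcValue, Arc.len, Arc.head, ← ht, hone]
    | revRow i =>
      simp only [Arc.tail, sub_add_cancel] at ht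
      have h : ((i : ℕ) : ZMod n) = ((t - k : ℤ) : ZMod n) := by simp [ht]
      have hw := hwin (t - k) k
      rw [← h, sub_add_cancel] at hw
      simp [arcValue, Arc.len, Arc.head, ht, hw, ← sub_eq_add_neg]
    | revShort j =>
      simp only [Arc.tail] at ht
      have h : j = ((t - 1 : ℤ) : ZMod n) := by simp [ht]
      have hw := hone (t - 1)
      rw [← h, sub_add_cancel] at hw
      simp [arcValue, Arc.len, Arc.head, ht, hw, ← sub_eq_add_neg]
  have hwalk : ∀ (γ : List (Arc n n)) (t : ℤ),
      (γ.IsChain fun a b =>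
        Arc.head (fun i : Fin n => ((i : ℕ) : ZMod n)) (fun _ => k) a =
          Arc.tail (fun i : Fin n => ((i : ℕ) : ZMod n)) (fun _ => k) b) →
      (∀ a ∈ γ.head?, (t : ZMod n) =
        Arc.tail (fun i : Fin n => ((i : ℕ) : ZMod n)) (fun _ => k) a + 1) →
      (γ.map (arcValue k y)).sum = Y (t + windingSum (fun _ => k) γ) - Y t := by
    intro γ
    induction γ with
    | nil => intro t _ _; simp [windingSum]
    | cons a l ih =>
      intro t hc ht
      obtain ⟨h1, h2⟩ := harc a t (ht a (by simp))
      rw [List.isChain_cons] at hc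
      have := ih (t + Arc.len (fun _ => k) a) hc.2 (fun b hb => by rw [h2, hc.1 b hb])
      simp only [List.map_cons, List.sum_cons, this, h1, windingSum, add_assoc]
      ring
  cases γ with
  | nil =>
    simp only [windingSum, List.map_nil, List.sum_nil, mul_eq_zero, Nat.cast_eq_zero,
      NeZero.ne n, or_false] at hp
    simp [hp]
  | cons a l =>
    obtain ⟨t, ht⟩ := ZMod.intCast_surjective
      (Arc.tail (fun i : Fin n => ((i : ℕ) : ZMod n)) (fun _ => k) a + 1)
    rw [hwalk (a :: l) t hγ (by simpa using ht), ← hp, hper]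
    ring

lemma sum_arcSlack [NeZero n] {k : ℕ} (c : ℝ) (x y : ZMod n → ℝ) {γ : List (Arc n n)} {p : ℤ}
    (hγ : γ.IsChain fun a b =>
      Arc.head (fun i : Fin n => ((i : ℕ) : ZMod n)) (fun _ => k) a =
        Arc.tail (fun i : Fin n => ((i : ℕ) : ZMod n)) (fun _ => k) b)
    (hrow : ∀ a ∈ γ, ¬ Arc.IsRevRow a) (hshort : ∀ a ∈ γ, ¬ Arc.IsFwdShort a)
    (hp : p * (n : ℤ) = windingSum (fun _ : Fin n => k) γ) :
    (γ.map (arcSlack k c x y)).sum = p * ∑ j, y j +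
      ∑ j, (pMinus (fun i : Fin n => ((i : ℕ) : ZMod n)) (fun _ => k) γ j : ℝ) * x j -
        c * numRowArcs γ := by
  rw [← sum_arcValue y hγ hp]
  clear hγ hp
  induction γ with
  | nil => simp [pMinus, numRowArcs]
  | cons a l ih =>
    simp only [List.mem_cons, forall_eq_or_imp] at hrow hshort
    have := ih hrow.2 hshort.2
    cases a with
    | fwdRow i =>
      simp only [pMinus, numRowArcs] at this ⊢
      simp [arcSlack, arcValue, this, Arc.IsForward]
      ring
    | fwdShort j => exact absurd trivial hshort.1
    | revRow i => exact absurd trivial hrow.1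
    | revShort j =>
      simp only [pMinus, numRowArcs] at this ⊢
      simp [arcSlack, arcValue, this, List.countP_cons, Arc.IsForward, Arc.Jumps,
        add_mul, sum_add_distrib]
      ring

lemma tVal_const (c : ℤ) {γ : List (Arc n n)} (hrow : ∀ a ∈ γ, ¬ Arc.IsRevRow a) :
    tVal (fun _ => c) γ = c * numRowArcs γ := by
  induction γ with
  | nil => simp [tVal, numRowArcs]
  | cons a l ih =>
    simp only [List.mem_cons, forall_eq_or_imp] at hrow
    have := ih hrow.2
    cases a with
    | revRow i => exact absurd trivial hrow.1
    | _ =>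
      simp only [tVal, numRowArcs] at this ⊢
      simp [this, mul_add, add_comm]

lemma tMinusVal_eq_zero (b : Fin n → ℤ) {γ : List (Arc n n)}
    (hrow : ∀ a ∈ γ, ¬ Arc.IsRevRow a) : tMinusVal b γ = 0 := by
  induction γ with
  | nil => simp [tMinusVal]
  | cons a l ih =>
    simp only [List.mem_cons, forall_eq_or_imp] at hrow
    have := ih hrow.2
    cases a with
    | revRow i => exact absurd trivial hrow.1
    | _ => simpa [tMinusVal] using this

lemma windingSum_const (k : ℕ) {γ : List (Arc n n)}
    (hrow : ∀ a ∈ γ, ¬ Arc.IsRevRow a) (hshort : ∀ a ∈ γ, ¬ Arc.IsFwdShort a) :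
    windingSum (fun _ : Fin n => k) γ = (k + 1) * numRowArcs γ - γ.length := by
  induction γ with
  | nil => simp [windingSum, numRowArcs]
  | cons a l ih =>
    simp only [List.mem_cons, forall_eq_or_imp] at hrow hshort
    have := ih hrow.2 hshort.2
    cases a with
    | fwdShort j => exact absurd trivial hshort.1
    | revRow i => exact absurd trivial hrow.1
    | _ =>
      simp only [windingSum, numRowArcs] at this ⊢
      simp [this, Arc.len]
      ring

lemma sum_arcSlack_self_nonneg {k : ℕ} {c : ℝ} {x : ZMod n → ℝ}
    (hx : ∀ u, c ≤ windowSum k x u) (γ : List (Arc n n)) :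
    0 ≤ (γ.map (arcSlack k c x x)).sum := by
  refine List.sum_nonneg fun r hr => ?_
  obtain ⟨a, -, rfl⟩ := List.mem_map.1 hr
  cases a <;> simp [arcSlack, hx]

lemma gammaIneqHolds_iff [NeZero n] (k : ℕ) (α : ℕ) {γ : List (Arc n n)} (p : ℤ)
    (hrow : ∀ a ∈ γ, ¬ Arc.IsRevRow a) (x : ZMod n → ℝ) :
    GammaIneqHolds (fun i : Fin n => ((i : ℕ) : ZMod n)) (fun _ => k) (fun _ => (α : ℤ)) γ p x ↔
      ((α * numRowArcs γ - (α * numRowArcs γ : ℤ).fdiv p * p : ℤ) : ℝ) *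
          (((α * numRowArcs γ : ℤ).fdiv p : ℤ) + 1 - ∑ j, x j) ≤
        ∑ j, (pMinus (fun i : Fin n => ((i : ℕ) : ZMod n)) (fun _ => k) γ j : ℝ) * x j := by
  simp only [GammaIneqHolds, rVal, betaVal, tMinusVal_eq_zero _ hrow, tVal_const _ hrow,
    add_mul, sum_add_distrib, ← mul_sum]
  constructor <;> intro h <;> push_cast at h ⊢ <;> linarith

/-- The `Γ`-inequality holds at integral points with `P = ∑ⱼ p⁻(γ,j) xⱼ` and `S = ∑ⱼ xⱼ`. -/
lemma gamma_bound_of_int {t p S : ℤ} {P : ℝ} (ht : 0 ≤ t) (hS : 0 ≤ S) (hP : 0 ≤ P)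
    (h : (t : ℝ) ≤ p * S + P) :
    ((t - t.fdiv p * p : ℤ) : ℝ) * ((t.fdiv p : ℤ) + 1 - (S : ℝ)) ≤ P := by
  obtain ⟨r, hr⟩ : ∃ r, t - t.fdiv p * p = r := ⟨_, rfl⟩
  obtain ⟨b, hb⟩ : ∃ b, t.fdiv p = b := ⟨_, rfl⟩
  rw [hr, hb]
  rw [hb] at hr
  have hmod : t.fmod p = r := by rw [Int.fmod_def, hb, ← hr]; ring
  have htR : (t : ℝ) = r + b * p := by exact_mod_cast (by linarith : t = r + b * p)
  rcases lt_trichotomy p 0 with hp | rfl | hp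
  · have hneg : (-t).fmod (-p) = -r := by rw [Int.neg_fmod_neg, hmod]
    have hr0 : 0 ≤ -r := hneg ▸ Int.fmod_nonneg_of_pos _ (by omega)
    have hrp : -r < -p := hneg ▸ Int.fmod_lt_of_pos _ (by omega)
    have hb0 : b ≤ S := by
      by_contra hlt
      push Not at hlt
      nlinarith
    have h1 : (0 : ℝ) ≤ (r - p) * (S - b) :=
      mul_nonneg (by exact_mod_cast (by omega : 0 ≤ r - p)) (by exact_mod_cast (by omega : 0 ≤ S - b))
    nlinarith
  · have : b = 0 := by simpa using hb.symm
    subst this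
    have h1 : (0 : ℝ) ≤ r * S := by
      have : 0 ≤ r * S := mul_nonneg (by omega) hS
      exact_mod_cast this
    push_cast at *
    nlinarith
  · have hr0 : 0 ≤ r := hmod ▸ Int.fmod_nonneg_of_pos _ hp
    have hrp : r < p := hmod ▸ Int.fmod_lt_of_pos _ hp
    rcases le_or_gt S b with hSb | hSb
    · have h1 : (0 : ℝ) ≤ (p - r) * (b - S) :=
        mul_nonneg (by exact_mod_cast (by omega : 0 ≤ p - r)) (by exact_mod_cast (by omega : 0 ≤ b - S))
      nlinarith
    · have h1 : (0 : ℝ) ≤ r * (S - (b + 1)) :=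
        mul_nonneg (by exact_mod_cast hr0) (by exact_mod_cast (by omega : 0 ≤ S - (b + 1)))
      nlinarith

lemma exists_int_sum_eq [NeZero n] {x : ZMod n → ℝ} (hx : IsIntegerPoint x) :
    ∃ S : ℤ, ∑ j, x j = S := by
  choose z hz using hx
  exact ⟨∑ j, z j, by simp [hz]⟩

lemma gammaIneqHolds_of_isIntegerPoint [NeZero n] {k α : ℕ} {x : ZMod n → ℝ}
    (hint : IsIntegerPoint x) (h0 : 0 ≤ x) (hx : ∀ u, (α : ℝ) ≤ windowSum k x u)
    {γ : List (Arc n n)} {p : ℤ}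
    (hγ : IsCircuit (fun i : Fin n => ((i : ℕ) : ZMod n)) (fun _ => k) γ)
    (hrow : ∀ a ∈ γ, ¬ Arc.IsRevRow a) (hshort : ∀ a ∈ γ, ¬ Arc.IsFwdShort a)
    (hp : p * (n : ℤ) = windingSum (fun _ : Fin n => k) γ) :
    GammaIneqHolds (fun i : Fin n => ((i : ℕ) : ZMod n)) (fun _ => k)
      (fun _ => (α : ℤ)) γ p x := by
  obtain ⟨⟨_, hchain, _⟩, _⟩ := hγ
  obtain ⟨S, hS⟩ := exists_int_sum_eq hint
  have hsl := sum_arcSlack_self_nonneg hx γ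
  rw [sum_arcSlack _ x x hchain hrow hshort hp, hS] at hsl
  rw [gammaIneqHolds_iff k α p hrow, hS]
  refine gamma_bound_of_int (by positivity) ?_ ?_ ?_
  · have : (0 : ℝ) ≤ S := hS ▸ sum_nonneg fun j _ => h0 j
    exact_mod_cast this
  · exact sum_nonneg fun j _ => mul_nonneg (by positivity) (h0 j)
  · push_cast
    linarith

lemma convex_setOf_gammaIneqHolds [NeZero n] (ℓ : Fin n → ZMod n) (k : Fin n → ℕ)
    (b : Fin n → ℤ) (γ : List (Arc n n)) (p : ℤ) :
    Convex ℝ {x | GammaIneqHolds ℓ k b γ p x} := by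
  intro x hx y hy s t hs ht hst
  simp only [Set.mem_ofPred_eq, GammaIneqHolds, ge_iff_le] at hx hy ⊢
  have := add_le_add (mul_le_mul_of_nonneg_left hx hs) (mul_le_mul_of_nonneg_left hy ht)
  rw [← add_mul, hst, one_mul, mul_sum, mul_sum, ← sum_add_distrib] at this
  refine this.trans_eq (sum_congr rfl fun j _ => ?_)
  simp only [Pi.add_apply, Pi.smul_apply, smul_eq_mul]
  ring

lemma intervalIntegrable_floor_add (c : ℝ) :
    IntervalIntegrable (fun ω : ℝ => (⌊c + ω⌋ : ℝ)) MeasureTheory.volume 0 1 := by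
  refine Monotone.intervalIntegrable fun a b hab => ?_
  exact_mod_cast Int.floor_le_floor (by linarith)

lemma integral_floor_add_sub_floor_add (c d : ℝ) :
    ∫ ω in (0 : ℝ)..1, ((⌊d + ω⌋ : ℝ) - ⌊c + ω⌋) = d - c := by
  have key : ∀ e : ℝ, ∫ ω in (0 : ℝ)..1, (⌊e + ω⌋ : ℝ) =
      e + 1 / 2 - ∫ ω in (0 : ℝ)..1, Int.fract ω := by
    intro e
    have hper : Function.Periodic (Int.fract : ℝ → ℝ) 1 := fun t => Int.fract_add_one t
    have h1 : ∫ ω in (0 : ℝ)..1, Int.fract (e + ω) = ∫ ω in (0 : ℝ)..1, Int.fract ω := by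
      rw [intervalIntegral.integral_comp_add_left (fun t => Int.fract t)]
      simpa using hper.intervalIntegral_add_eq e 0
    have h2 : (fun ω : ℝ => Int.fract (e + ω)) = fun ω => (e + ω) - (⌊e + ω⌋ : ℝ) := by
      ext ω
      exact (Int.self_sub_floor _).symm
    rw [← h1, h2, intervalIntegral.integral_sub
      ((by fun_prop : Continuous fun ω : ℝ => e + ω).intervalIntegrable _ _)
      (intervalIntegrable_floor_add e)]
    rw [intervalIntegral.integral_add (by simp) (by simp)]
    simp
  rw [intervalIntegral.integral_sub (intervalIntegrable_floor_add d)
    (intervalIntegrable_floor_add c), key, key]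
  ring

/-- A point of `Q(Cₙᵏ, α·1)` whose coordinates sum up to an integer is in `Q*(Cₙᵏ, α·1)`:
it is the mean of its threshold roundings. -/
lemma mem_Qstar_of_sum_int [NeZero n] {k α : ℕ} (hk : k ≤ n) {y : ZMod n → ℝ}
    (h0 : 0 ≤ y) (hy : ∀ u, (α : ℝ) ≤ windowSum k y u) {S : ℤ} (hS : ∑ j, y j = S) :
    y ∈ Qstar (circMatrix (fun i : Fin n => ((i : ℕ) : ZMod n)) (fun _ => k))
      (fun _ => (α : ℝ)) := by
  obtain ⟨Y, hwin, hper⟩ := exists_primitive y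
  have hone : ∀ t : ℤ, y (t : ZMod n) = Y (t + 1) - Y t := fun t => by
    simpa [windowSum] using hwin t 1
  have hyu : ∀ u : ZMod n, y u = Y ((u.val : ℤ) + 1) - Y (u.val : ℤ) := fun u => by
    have := hone (u.val : ℤ)
    rwa [Int.cast_natCast, ZMod.natCast_zmod_val] at this
  let f : ℝ → ZMod n → ℝ := fun ω u => (⌊Y ((u.val : ℤ) + 1) + ω⌋ : ℝ) - ⌊Y (u.val : ℤ) + ω⌋
  have hf : ∀ ω (t : ℤ), f ω (t : ZMod n) = (⌊Y (t + 1) + ω⌋ : ℝ) - ⌊Y t + ω⌋ := by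
    intro ω t
    have hval : (((t : ZMod n).val : ℕ) : ℤ) = t + (-(t / n)) * n := by
      rw [ZMod.val_intCast, Int.emod_def]
      ring
    have hshift : ∀ s : ℤ, ⌊Y (s + (-(t / n)) * n) + ω⌋ = ⌊Y s + ω⌋ + (-(t / n)) * S := by
      intro s
      rw [hper, hS, ← Int.floor_add_intCast]
      push_cast
      ring_nf
    simp only [f, hval]
    rw [show t + (-(t / n)) * n + 1 = (t + 1) + (-(t / n)) * n by ring, hshift, hshift]
    push_cast
    ring
  have hfwin : ∀ ω (t : ℤ), windowSum k (f ω) (t : ZMod n) =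
      (⌊Y (t + k) + ω⌋ : ℝ) - ⌊Y t + ω⌋ := by
    intro ω t
    have : ∀ m : ℕ, windowSum m (f ω) (t : ZMod n) = (⌊Y (t + m) + ω⌋ : ℝ) - ⌊Y t + ω⌋ := by
      intro m
      induction m with
      | zero => simp [windowSum]
      | succ m ih =>
        have h := hf ω (t + m)
        rw [windowSum, sum_range_succ, ← windowSum, ih]
        push_cast at h ⊢
        rw [h, add_assoc t]
        ring
    exact this k
  have hf0 : ∀ ω, 0 ≤ f ω := by
    intro ω u
    have h : Y (u.val : ℤ) ≤ Y ((u.val : ℤ) + 1) := by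
      have h1 := hyu u
      have h2 : 0 ≤ y u := h0 u
      linarith
    have : ⌊Y (u.val : ℤ) + ω⌋ ≤ ⌊Y ((u.val : ℤ) + 1) + ω⌋ := Int.floor_le_floor (by linarith)
    simpa [f] using this
  have hfmem : ∀ ω, f ω ∈ {x | IsIntegerPoint x ∧
      x ∈ Qpoly (circMatrix (fun i : Fin n => ((i : ℕ) : ZMod n)) (fun _ => k))
        (fun _ => (α : ℝ))} := by
    refine fun ω => ⟨fun u => ⟨⌊Y ((u.val : ℤ) + 1) + ω⌋ - ⌊Y (u.val : ℤ) + ω⌋, by simp [f]⟩,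
      (mem_Qpoly_iff hk _ _).2 ⟨hf0 ω, fun u => ?_⟩⟩
    obtain ⟨t, rfl⟩ := ZMod.intCast_surjective u
    have h1 := hy (t : ZMod n)
    rw [hwin] at h1
    have h2 : ⌊Y t + ω⌋ + (α : ℤ) ≤ ⌊Y (t + k) + ω⌋ := by
      rw [← Int.floor_add_natCast]
      exact Int.floor_le_floor (by linarith)
    rw [hfwin, le_sub_iff_add_le']
    exact_mod_cast h2
  have hfin : (Set.range f).Finite := by
    refine (Set.Finite.pi (t := fun u => (fun z : ℤ => (z : ℝ)) '' Set.Icc 0 (⌈y u⌉))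
      fun u => (Set.finite_Icc _ _).image _).subset ?_
    rintro _ ⟨ω, rfl⟩ u -
    refine ⟨⌊Y ((u.val : ℤ) + 1) + ω⌋ - ⌊Y (u.val : ℤ) + ω⌋, ⟨?_, ?_⟩, by simp [f]⟩
    · have : (0 : ℝ) ≤ f ω u := hf0 ω u
      simp only [f] at this
      exact_mod_cast this
    · rw [sub_le_iff_le_add', ← Int.lt_add_one_iff, Int.floor_lt]
      have h1 := hyu u
      have h2 := Int.le_ceil (y u)
      have h3 := Int.lt_floor_add_one (Y (u.val : ℤ) + ω)
      push_cast
      linarith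
  have hint : ∀ u, MeasureTheory.Integrable (fun ω => f ω u)
      (MeasureTheory.volume.restrict (Set.Ioc (0 : ℝ) 1)) := fun u =>
    (((intervalIntegrable_floor_add _).sub (intervalIntegrable_floor_add _)).1)
  have hprob : MeasureTheory.IsProbabilityMeasure
      (MeasureTheory.volume.restrict (Set.Ioc (0 : ℝ) 1)) := ⟨by simp⟩
  have hmem := (convex_convexHull ℝ (Set.range f)).integral_mem
    (hfin.isCompact_convexHull (𝕜 := ℝ)).isClosed
    (Filter.Eventually.of_forall fun ω => subset_convexHull ℝ _ ⟨ω, rfl⟩)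
    (MeasureTheory.Integrable.of_eval hint)
  have hval : ∫ ω, f ω ∂(MeasureTheory.volume.restrict (Set.Ioc (0 : ℝ) 1)) = y := by
    ext u
    rw [MeasureTheory.eval_integral hint, ← intervalIntegral.integral_of_le zero_le_one]
    rw [hyu]
    exact integral_floor_add_sub_floor_add _ _
  rw [hval] at hmem
  exact convexHull_mono (Set.range_subset_iff.2 hfmem) hmem

/-- Following distinguished out-arcs inside a nonempty set of nodes yields a circuit. -/
lemma exists_circuit_of_out_arcs [NeZero n] {k : ℕ} {T : Set (ZMod n)} (hT : T.Nonempty)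
    (g : ZMod n → Arc n n)
    (htail : ∀ u, Arc.tail (fun i : Fin n => ((i : ℕ) : ZMod n)) (fun _ => k) (g u) = u)
    (hhead : ∀ u ∈ T, Arc.head (fun i : Fin n => ((i : ℕ) : ZMod n)) (fun _ => k) (g u) ∈ T) :
    ∃ (γ : List (Arc n n)) (p : ℤ),
      IsCircuit (fun i : Fin n => ((i : ℕ) : ZMod n)) (fun _ => k) γ ∧
      (∀ a ∈ γ, ∃ u ∈ T, a = g u) ∧ p * (n : ℤ) = windingSum (fun _ : Fin n => k) γ := by
  have hlen : ∀ a : Arc n n, ((Arc.len (fun _ => k) a : ℤ) : ZMod n) =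
      Arc.head (fun i : Fin n => ((i : ℕ) : ZMod n)) (fun _ => k) a -
        Arc.tail (fun i : Fin n => ((i : ℕ) : ZMod n)) (fun _ => k) a := by
    intro a
    cases a <;> simp [Arc.len, Arc.head, Arc.tail]
  set f : ZMod n → ZMod n :=
    fun u => Arc.head (fun i : Fin n => ((i : ℕ) : ZMod n)) (fun _ => k) (g u) with hf
  obtain ⟨u, hu⟩ := hT
  have hiter : ∀ i, f^[i] u ∈ T := by
    intro i
    induction i with
    | zero => exact hu
    | succ i ih => rw [Function.iterate_succ_apply']; exact hhead _ ih
  obtain ⟨v, hvT, hv⟩ : ∃ v, (∀ i, f^[i] v ∈ T) ∧ v ∈ Function.periodicPts f := by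
    obtain ⟨i, j, hij, h⟩ := Set.finite_univ.exists_lt_map_eq_of_forall_mem
      (f := fun i : ℕ => f^[i] u) (fun _ => Set.mem_univ _)
    refine ⟨f^[i] u, fun l => ?_, j - i, by omega, ?_⟩
    · rw [← Function.iterate_add_apply]
      exact hiter _
    · rw [Function.IsPeriodicPt, Function.IsFixedPt, ← Function.iterate_add_apply,
        Nat.sub_add_cancel hij.le]
      exact h.symm
  have hm := Function.minimalPeriod_pos_of_mem_periodicPts hv
  obtain ⟨m, hm'⟩ := Nat.exists_eq_succ_of_ne_zero hm.ne'
  have hwind : ((windingSum (fun _ : Fin n => k)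
      ((List.range (m + 1)).map fun i => g (f^[i] v)) : ℤ) : ZMod n) = 0 := by
    have : ∀ l, ((windingSum (fun _ : Fin n => k)
        ((List.range l).map fun i => g (f^[i] v)) : ℤ) : ZMod n) = f^[l] v - v := by
      intro l
      induction l with
      | zero => simp [windingSum]
      | succ l ih =>
        simp only [windingSum, List.map_map] at ih
        simp only [windingSum, List.range_succ, List.map_append, List.sum_append, List.map_map,
          List.map_cons, List.map_nil, List.sum_cons, List.sum_nil, add_zero, Int.cast_add,
          hlen, ih, htail, Function.iterate_succ_apply']
        simp [hf]
    rw [this, ← Nat.succ_eq_add_one, ← hm', Function.iterate_minimalPeriod, sub_self]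
  obtain ⟨p, hp⟩ := (ZMod.intCast_zmod_eq_zero_iff_dvd _ n).1 hwind
  refine ⟨(List.range (m + 1)).map fun i => g (f^[i] v), p,
    ⟨⟨by simp, ?_, ?_⟩, ?_⟩, ?_, by rw [hp, mul_comm]⟩
  · refine (List.isChain_map _).2 ((List.isChain_range _ _).2 fun i _ => ?_)
    rw [htail, Function.iterate_succ_apply']
  · have h1 : ((List.range (m + 1)).map fun i => g (f^[i] v)).getLast (by simp) = g (f^[m] v) := by
      simp [List.getLast_map]
    have h2 : ((List.range (m + 1)).map fun i => g (f^[i] v)).head (by simp) = g v := by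
      simp [List.head_map]
    rw [h1, h2, htail]
    have := Function.iterate_minimalPeriod (f := f) (x := v)
    rwa [hm', Function.iterate_succ_apply'] at this
  · rw [List.map_map]
    refine List.Nodup.map_on (fun i hi j hj hij => ?_) List.nodup_range
    simp only [Function.comp, htail] at hij
    rw [List.mem_range, ← Nat.succ_eq_add_one, ← hm'] at hi hj
    exact Function.iterate_injOn_Iio_minimalPeriod hi hj hij
  · intro a ha
    obtain ⟨i, -, rfl⟩ := List.mem_map.1 ha
    exact ⟨_, hvT i, rfl⟩

/-- Transfer `ε` units from node `u + 1` to node `u`. -/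
def transfer (u : ZMod n) (ε : ℝ) (y : ZMod n → ℝ) : ZMod n → ℝ :=
  fun j => y j + ε * ((if j = u then 1 else 0) - if j = u + 1 then 1 else 0)

lemma sum_transfer [NeZero n] (u : ZMod n) (ε : ℝ) (y : ZMod n → ℝ) :
    ∑ j, transfer u ε y j = ∑ j, y j := by
  simp [transfer, sum_add_distrib, ← mul_sum]

lemma windowSum_transfer (k : ℕ) (u : ZMod n) (ε : ℝ) (y : ZMod n → ℝ) (w : ZMod n) :
    windowSum k (transfer u ε y) w = windowSum k y w +
      ε * ((if w + (k : ZMod n) = u + 1 then 1 else 0) - if w = u + 1 then 1 else 0) := by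
  have h := sum_range_sub (fun s : ℕ => if w + (s : ZMod n) = u + 1 then (1 : ℝ) else 0) k
  simp only [windowSum, transfer, sum_add_distrib, ← mul_sum]
  congr 2
  simp only [Nat.cast_zero, add_zero] at h
  rw [← h]
  refine sum_congr rfl fun s _ => ?_
  simp [← add_assoc]

/-- The vectors (of any sign) below `x` whose row windows sum up to at least `c`. -/
def lowerCovers (k : ℕ) (c : ℝ) (x : ZMod n → ℝ) : Set (ZMod n → ℝ) :=
  {y | y ≤ x ∧ ∀ u, c ≤ windowSum k y u}

lemma isCompact_lowerCovers {k : ℕ} (hk : 0 < k) (c : ℝ) {x : ZMod n → ℝ} (hx : 0 ≤ x) :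
    IsCompact (lowerCovers k c x) := by
  have hclosed : IsClosed (lowerCovers k c x) := by
    have : lowerCovers k c x = {y | y ≤ x} ∩ ⋂ u, {y | c ≤ windowSum k y u} := by
      ext y
      simp [lowerCovers]
    rw [this]
    refine (isClosed_le continuous_id continuous_const).inter ?_
    exact isClosed_iInter fun u => isClosed_le continuous_const (continuous_windowSum k u)
  refine (isCompact_Icc (a := fun j => c - windowSum k x j) (b := x)).of_isClosed_subset
    hclosed fun y hy => ⟨fun j => ?_, hy.1⟩
  have h1 : (x - y) j ≤ windowSum k (x - y) j := by
    have := single_le_sum (f := fun s : ℕ => (x - y) (j + (s : ZMod n)))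
      (fun s _ => sub_nonneg.2 (hy.1 _)) (mem_range.2 hk)
    simpa [windowSum] using this
  have h2 := hy.2 j
  have h3 : 0 ≤ x j := hx j
  rw [windowSum_sub, Pi.sub_apply] at h1
  show c - windowSum k x j ≤ y j
  linarith

/-- At a node where neither `y ≤ x` nor the next row window is tight, some mass can be
transferred backwards without making any constraint tight. -/
lemma exists_transfer_mem_lowerCovers (h1 : (1 : ZMod n) ≠ 0) {k : ℕ} (hk : (k : ZMod n) ≠ 0)
    {c : ℝ} {x y : ZMod n → ℝ} (hy : y ∈ lowerCovers k c x) {u : ZMod n} (hu : y u ≠ x u)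
    (hw : windowSum k y (u + 1) ≠ c) :
    ∃ ε > 0, transfer u ε y ∈ lowerCovers k c x ∧
      (∀ j, transfer u ε y j = x j → y j = x j ∧ j ≠ u + 1) ∧
      ∀ w, windowSum k (transfer u ε y) w = c →
        windowSum k y w = c ∧ w + (k : ZMod n) ≠ u + 1 := by
  have hu' : y u < x u := lt_of_le_of_ne (hy.1 u) hu
  have hw' : c < windowSum k y (u + 1) := lt_of_le_of_ne (hy.2 _) hw.symm
  obtain ⟨ε, hε, hεmin⟩ := exists_between
    (lt_min (sub_pos.2 hu') (sub_pos.2 hw'))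
  rw [lt_min_iff] at hεmin
  have hne : u ≠ u + 1 := by simpa using h1
  have hval : ∀ j, transfer u ε y j ≤ x j ∧
      (transfer u ε y j = x j → y j = x j ∧ j ≠ u + 1) := by
    intro j
    have := hy.1 j
    unfold transfer
    by_cases hj : j = u
    · subst hj
      simp only [if_true, hne, if_false]
      exact ⟨by linarith, fun h => by linarith⟩
    · by_cases hj' : j = u + 1
      · subst hj'
        simp only [hne.symm, if_true, if_false]
        exact ⟨by linarith, fun h => by linarith⟩
      · simp only [hj, hj', if_false]
        exact ⟨by linarith, fun h => ⟨by linarith, hj'⟩⟩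
  have hwin : ∀ w, c ≤ windowSum k (transfer u ε y) w ∧
      (windowSum k (transfer u ε y) w = c → windowSum k y w = c ∧ w + (k : ZMod n) ≠ u + 1) := by
    intro w
    have := hy.2 w
    rw [windowSum_transfer]
    by_cases hj : w = u + 1
    · subst hj
      have : u + 1 + (k : ZMod n) ≠ u + 1 := by simpa using hk
      simp only [if_true, this, if_false]
      exact ⟨by linarith, fun h => by linarith⟩
    · by_cases hj' : w + (k : ZMod n) = u + 1
      · simp only [hj, hj', if_true, if_false]
        exact ⟨by linarith, fun h => by linarith⟩
      · simp only [hj, hj', if_false]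
        exact ⟨by linarith, fun h => ⟨by linarith, hj'⟩⟩
  exact ⟨ε, hε, ⟨fun j => (hval j).1, fun w => (hwin w).1⟩, fun j => (hval j).2,
    fun w => (hwin w).2⟩

/-- A lower cover of minimum sum has a tight row window. -/
lemma exists_windowSum_eq_of_isMinOn [NeZero n] {k : ℕ} (hk : 0 < k) {c : ℝ}
    {x y : ZMod n → ℝ} (hy : y ∈ lowerCovers k c x)
    (hmin : ∀ y' ∈ lowerCovers k c x, ∑ j, y j ≤ ∑ j, y' j) :
    ∃ w, windowSum k y w = c := by
  obtain ⟨w, -, hw⟩ := exists_min_image univ (windowSum k y) univ_nonempty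
  refine ⟨w, le_antisymm (not_lt.1 fun hlt => ?_) (hy.2 w)⟩
  have hk' : (0 : ℝ) < k := by exact_mod_cast hk
  have hn : (0 : ℝ) < n := by exact_mod_cast NeZero.pos n
  have hδ : 0 < (windowSum k y w - c) / k := div_pos (sub_pos.2 hlt) hk'
  have := hmin (fun j => y j - (windowSum k y w - c) / k)
    ⟨fun j => by linarith [hy.1 j], fun u => ?_⟩
  · simp only [sum_sub_distrib, sum_const, card_univ, ZMod.card, nsmul_eq_mul] at this
    nlinarith [mul_pos hn hδ]
  · have h1 := hw u (mem_univ u)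
    have h2 : windowSum k (fun j => y j - (windowSum k y w - c) / k) u =
        windowSum k y u - (windowSum k y w - c) := by
      simp only [windowSum, sum_sub_distrib, sum_const, card_range, nsmul_eq_mul]
      rw [mul_div_cancel₀ _ hk'.ne']
    linarith

/-- Among the lower covers of minimum sum, one has a circuit of tight constraints. -/
lemma exists_tight_circuit [NeZero n] (h1 : (1 : ZMod n) ≠ 0) {k : ℕ} (hk : (k : ZMod n) ≠ 0)
    {c : ℝ} {x y₀ : ZMod n → ℝ} (hy₀ : y₀ ∈ lowerCovers k c x)
    (hmin : ∀ y ∈ lowerCovers k c x, ∑ j, y₀ j ≤ ∑ j, y j) :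
    ∃ y ∈ lowerCovers k c x, ∑ j, y j = ∑ j, y₀ j ∧ ∃ (γ : List (Arc n n)) (p : ℤ),
      IsCircuit (fun i : Fin n => ((i : ℕ) : ZMod n)) (fun _ => k) γ ∧
      (∀ a ∈ γ, ¬ Arc.IsRevRow a) ∧ (∀ a ∈ γ, ¬ Arc.IsFwdShort a) ∧
      p * (n : ℤ) = windingSum (fun _ : Fin n => k) γ ∧ ∀ a ∈ γ, arcSlack k c x y a = 0 := by
  let tight : (ZMod n → ℝ) → Finset (ZMod n ⊕ ZMod n) := fun y =>
    (univ.filter fun j => y j = x j).disjSum (univ.filter fun w => windowSum k y w = c)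
  obtain ⟨y, ⟨hy, hsum⟩, hfew⟩ := WellFounded.has_min
    (InvImage.wf (fun y => (tight y).card) wellFounded_lt)
    {y | y ∈ lowerCovers k c x ∧ ∑ j, y j = ∑ j, y₀ j} ⟨y₀, hy₀, rfl⟩
  have hpush : ∀ u, (y (u + 1) = x (u + 1) ∨ ∃ w, windowSum k y w = c ∧ w + (k : ZMod n) = u + 1) →
      y u = x u ∨ windowSum k y (u + 1) = c := by
    intro u hout
    by_contra! hu
    obtain ⟨ε, -, hmem, hP, hR⟩ := exists_transfer_mem_lowerCovers h1 hk hy hu.1 hu.2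
    refine hfew _ ⟨hmem, (sum_transfer _ _ _).trans hsum⟩ (card_lt_card ?_)
    rw [ssubset_iff_of_subset]
    · rcases hout with h | ⟨w, h, hw⟩
      · exact ⟨Sum.inl (u + 1), by simpa [tight] using h,
          fun h' => (hP (u + 1) (by simpa [tight] using h')).2 rfl⟩
      · exact ⟨Sum.inr w, by simpa [tight] using h,
          fun h' => (hR w (by simpa [tight] using h')).2 hw⟩
    · rintro (j | w) h
      · simpa [tight] using (hP j (by simpa [tight] using h)).1
      · simpa [tight] using (hR w (by simpa [tight] using h)).1
  obtain ⟨w, hw⟩ := exists_windowSum_eq_of_isMinOn (Nat.pos_of_ne_zero (by rintro rfl; simp at hk)) hy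
    (hsum ▸ hmin)
  obtain ⟨γ, p, hγ, harc, hp⟩ := exists_circuit_of_out_arcs (k := k)
    (T := {u | y u = x u ∨ windowSum k y (u + 1) = c}) ⟨w - 1, Or.inr (by simpa using hw)⟩
    (fun u => if windowSum k y (u + 1) = c then Arc.fwdRow ⟨(u + 1).val, ZMod.val_lt _⟩
      else Arc.revShort u)
    (fun u => by split_ifs <;> simp [Arc.tail])
    (fun u hu => by
      split_ifs with h
      · refine hpush _ (Or.inr ⟨u + 1, h, ?_⟩)
        simp [Arc.head]
      · refine hpush _ (Or.inl ?_)
        simpa [Arc.head] using hu.resolve_right h)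
  refine ⟨y, hy, hsum, γ, p, hγ, ?_, ?_, hp, ?_⟩
  all_goals
    intro a ha
    obtain ⟨u, hu, rfl⟩ := harc a ha
    split_ifs with h
  any_goals exact not_false
  · simp [arcSlack, h]
  · simp [arcSlack, hu.resolve_right h]

lemma sum_windowSum [NeZero n] (k : ℕ) (y : ZMod n → ℝ) :
    ∑ u, windowSum k y u = k * ∑ j, y j := by
  unfold windowSum
  have h : ∀ s : ℕ, ∑ u, y (u + (s : ZMod n)) = ∑ j, y j := fun s =>
    Fintype.sum_equiv (Equiv.addRight (s : ZMod n)) _ y fun _ => rfl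
  rw [sum_comm, sum_congr rfl fun s _ => h s]
  simp

lemma val_sub_add_one_lt [NeZero n] {u v : ZMod n} (h : u ≠ v) :
    (v - (u + 1)).val < (v - u).val := by
  obtain ⟨d, hd⟩ : ∃ d, v - u = d := ⟨_, rfl⟩
  rw [← sub_sub, hd]
  have hd0 : d.val ≠ 0 := by
    rw [ne_eq, ZMod.val_eq_zero, ← hd, sub_eq_zero]
    exact h.symm
  have hcast : d - 1 = ((d.val - 1 : ℕ) : ZMod n) := by
    rw [Nat.cast_sub (by omega), ZMod.natCast_zmod_val, Nat.cast_one]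
  have := ZMod.val_lt d
  rw [hcast, ZMod.val_natCast, Nat.mod_eq_of_lt (by omega)]
  omega

/-- If all covers of a given sum have a tight constraint at `v`, one of them has a tight
constraint at every node. -/
lemma exists_forall_tight [NeZero n] (h1 : (1 : ZMod n) ≠ 0) {k : ℕ} (hk : (k : ZMod n) ≠ 0)
    {c θ : ℝ} {x : ZMod n → ℝ} (hx : 0 ≤ x) {v : ZMod n}
    (hne : ∃ y ∈ lowerCovers k c x, ∑ j, y j = θ)
    (hv : ∀ y ∈ lowerCovers k c x, ∑ j, y j = θ → y v = x v ∨ windowSum k y (v + 1) = c) :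
    ∃ y ∈ lowerCovers k c x, ∑ j, y j = θ ∧ ∀ u, y u = x u ∨ windowSum k y (u + 1) = c := by
  have hcomp : IsCompact (lowerCovers k c x ∩ {y | ∑ j, y j = θ}) :=
    (isCompact_lowerCovers (Nat.pos_of_ne_zero (by rintro rfl; simp at hk)) c hx).inter_right
      (isClosed_eq (by fun_prop) continuous_const)
  obtain ⟨y, ⟨hy, hsum⟩, hmax⟩ := hcomp.exists_isMaxOn hne
    (f := fun y => ∑ j, ((v - j).val : ℝ) * y j) (by fun_prop)
  refine ⟨y, hy, hsum, fun u => ?_⟩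
  by_contra! hu
  have huv : u ≠ v := by
    rintro rfl
    exact (hv y hy hsum).elim hu.1 hu.2
  obtain ⟨ε, hε, hmem, -⟩ := exists_transfer_mem_lowerCovers h1 hk hy hu.1 hu.2
  have hle := hmax ⟨hmem, (sum_transfer u ε y).trans hsum⟩
  have hΦ : ∑ j, ((v - j).val : ℝ) * transfer u ε y j = ∑ j, ((v - j).val : ℝ) * y j +
      ε * ((v - u).val - (v - (u + 1)).val) := by
    simp only [transfer, mul_add, mul_sub, sum_add_distrib, sum_sub_distrib]
    simp [mul_comm]
  have hlt : ((v - (u + 1)).val : ℝ) < (v - u).val := by exact_mod_cast val_sub_add_one_lt huv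
  rw [Set.mem_ofPred_eq] at hle
  beta_reduce at hle
  rw [hΦ] at hle
  nlinarith

/-- The complement of an everywhere tight cover of `x` is a cover. -/
lemma le_windowSum_sub_of_tight [NeZero n] {k : ℕ} {c d : ℝ} {x y : ZMod n → ℝ} (hyx : y ≤ x)
    (hne : y ≠ x) (hx : ∀ u, c + d ≤ windowSum k x u)
    (htight : ∀ u, y u = x u ∨ windowSum k y (u + 1) = c) (u : ZMod n) :
    d ≤ windowSum k (x - y) u := by
  by_contra! hu
  have hstep : ∀ w, windowSum k (x - y) (w + 1) < d → y w = x w ∧ windowSum k (x - y) w < d := by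
    intro w hw
    have hP : y w = x w := (htight w).resolve_right fun h => by
      have := hx (w + 1)
      rw [windowSum_sub] at hw
      linarith
    refine ⟨hP, ?_⟩
    have h1 := windowSum_add_one k (x - y) w
    have h2 : 0 ≤ (x - y) (w + (k : ZMod n)) := sub_nonneg.2 (hyx _)
    have h3 : (x - y) w = 0 := sub_eq_zero.2 hP.symm
    linarith
  have hall : ∀ i : ℕ, windowSum k (x - y) (u - (i : ZMod n)) < d := by
    intro i
    induction i with
    | zero => simpa using hu
    | succ i ih =>
      refine (hstep _ ?_).2
      rwa [Nat.cast_succ, ← sub_sub, sub_add_cancel]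
  refine hne (funext fun w => (hstep w ?_).1)
  have := hall (u - (w + 1)).val
  rwa [ZMod.natCast_zmod_val, sub_sub_cancel] at this

/-- An everywhere tight cover is nonnegative, unless all its row windows are tight. -/
lemma nonneg_of_tight [NeZero n] {k : ℕ} {c : ℝ} {x y : ZMod n → ℝ} (hx : 0 ≤ x)
    (hy : ∀ u, c ≤ windowSum k y u) (hne : k * ∑ j, y j ≠ n * c)
    (htight : ∀ u, y u = x u ∨ windowSum k y (u + 1) = c) : 0 ≤ y := by
  intro u
  by_contra! hu
  have hstep : ∀ w, y w < 0 → windowSum k y (w + 1) = c ∧ y (w + (k : ZMod n)) < 0 := by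
    intro w hw
    have hR : windowSum k y (w + 1) = c := (htight w).resolve_left fun h => by
      have : 0 ≤ x w := hx w
      linarith
    refine ⟨hR, ?_⟩
    have h1 := windowSum_add_one k y w
    have h2 := hy w
    linarith
  have hall : ∀ i : ℕ, y (u + (i : ZMod n) * (k : ZMod n)) < 0 := by
    intro i
    induction i with
    | zero => simpa using hu
    | succ i ih =>
      have := (hstep _ ih).2
      rwa [add_assoc, ← add_one_mul, ← Nat.cast_succ] at this
  refine hne ?_
  have hwin : ∀ i : ℕ, windowSum k y (u + 1 + (i : ZMod n) * (k : ZMod n)) = c := fun i => by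
    rw [add_right_comm]
    exact (hstep _ (hall i)).1
  rw [← sum_windowSum_orbit k y (u + 1), sum_congr rfl fun i _ => hwin i]
  simp

/-- If all row windows of some lower cover are tight, then all row windows of some nonnegative
lower cover are. -/
lemma exists_nonneg_windowSum_eq [NeZero n] {k : ℕ} {c : ℝ} (hc : 0 < c) {x y : ZMod n → ℝ}
    (hx : 0 ≤ x) (hy : y ∈ lowerCovers k c x) (hsum : k * ∑ j, y j = n * c) :
    ∃ z : ZMod n → ℝ, 0 ≤ z ∧ z ≤ x ∧ ∀ u, windowSum k z u = c := by
  have hwin : ∀ u, windowSum k y u = c := by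
    have h0 : ∑ u, (windowSum k y u - c) = 0 := by
      rw [sum_sub_distrib, sum_windowSum, hsum]
      simp
    rw [sum_eq_zero_iff_of_nonneg fun u _ => sub_nonneg.2 (hy.2 u)] at h0
    exact fun u => sub_eq_zero.1 (h0 u (mem_univ u))
  have hyper : ∀ u, y (u + (k : ZMod n)) = y u := fun u => by
    have := windowSum_add_one k y u
    rw [hwin, hwin] at this
    linarith
  have hyorbit : ∀ (i : ℕ) u, y (u + (i : ZMod n) * (k : ZMod n)) = y u := by
    intro i u
    induction i with
    | zero => simp
    | succ i ih => rw [Nat.cast_succ, add_one_mul, ← add_assoc, hyper, ih]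
  let z : ZMod n → ℝ := fun j => univ.inf' univ_nonempty fun i : ZMod n => x (j + i * (k : ZMod n))
  have hyz : y ≤ z := fun j => le_inf' _ _ fun i _ => by
    rw [← hyorbit i.val j, ZMod.natCast_zmod_val]
    exact hy.1 _
  have hzx : z ≤ x := fun j => (inf'_le _ (mem_univ 0)).trans (by simp)
  have hz0 : 0 ≤ z := fun j => le_inf' _ _ fun i _ => hx (j + i * (k : ZMod n))
  have hzper : ∀ j, z (j + (k : ZMod n)) = z j := by
    intro j
    refine le_antisymm (le_inf' _ _ fun i _ => ?_) (le_inf' _ _ fun i _ => ?_)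
    · refine (inf'_le _ (mem_univ (i - 1))).trans (le_of_eq ?_)
      congr 1
      ring
    · refine (inf'_le _ (mem_univ (i + 1))).trans (le_of_eq ?_)
      congr 1
      ring
  have hzwin : ∀ u, windowSum k z u = windowSum k z 0 := by
    intro u
    rw [← ZMod.natCast_zmod_val u]
    induction u.val with
    | zero => simp
    | succ i ih =>
      have := windowSum_add_one k z i
      rw [hzper, ih] at this
      rw [Nat.cast_succ]
      linarith
  have hW : c ≤ windowSum k z 0 := hwin 0 ▸ windowSum_mono k hyz 0
  have hWpos := hc.trans_le hW
  refine ⟨(c / windowSum k z 0) • z, fun j => mul_nonneg (by positivity) (hz0 j), fun j => ?_,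
    fun u => ?_⟩
  · exact (mul_le_of_le_one_left (hz0 j) ((div_le_one hWpos).2 hW)).trans (hzx j)
  · rw [windowSum_smul, hzwin u, div_mul_cancel₀ _ hWpos.ne']

/-- The bound on a lower cover of minimum sum that a `Γ`-inequality provides, with
`t = t(Γ)`, `p = p(Γ)`, `P = ∑ⱼ p⁻(Γ,j) xⱼ` and `S = ∑ⱼ xⱼ`. -/
lemma mul_sub_le_of_gamma_bound {t p β : ℤ} {S P : ℝ} (hp : 0 < p) (hβ : β < S) (hβ' : S < β + 1)
    (hP : 0 ≤ P) (hS : (t : ℝ) ≤ p * S + P)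
    (h : ((t - t.fdiv p * p : ℤ) : ℝ) * ((t.fdiv p : ℤ) + 1 - S) ≤ P) :
    (β + 1 - S) * (t - p * β) ≤ P := by
  have hmod : t.fmod p = t - t.fdiv p * p := by rw [Int.fmod_def]; ring
  have hr0 := Int.fmod_nonneg_of_pos t hp
  have hrp := Int.fmod_lt_of_pos t hp
  rw [hmod] at hr0 hrp
  generalize t.fdiv p = b at *
  have hp' : (0 : ℝ) < p := by exact_mod_cast hp
  rcases lt_trichotomy b β with hb | rfl | hb
  · have h1 : t - p * β ≤ 0 := by nlinarith
    have h2 : (t - p * β : ℝ) ≤ 0 := by exact_mod_cast h1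
    nlinarith
  · push_cast at h
    nlinarith
  · have h1 : 0 ≤ t - p * (β + 1) := by nlinarith
    have h2 : (0 : ℝ) ≤ t - p * (β + 1) := by exact_mod_cast h1
    nlinarith [mul_nonneg (sub_nonneg.2 hβ.le) h2]

lemma arcSlack_nonneg {k : ℕ} {c : ℝ} {x y : ZMod n → ℝ} (hy : y ∈ lowerCovers k c x)
    (a : Arc n n) : 0 ≤ arcSlack k c x y a := by
  cases a with
  | fwdRow i => exact sub_nonneg.2 (hy.2 _)
  | revShort j => exact sub_nonneg.2 (hy.1 j)
  | _ => exact le_rfl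

/-- A point `x` satisfying the `Γ`-inequalities splits as `y + (x - y)`, with `y` a cover of `μ α`
of sum at most `μ ⌊∑ⱼ xⱼ⌋` and `x - y` a cover of `(1 - μ) α`. -/
lemma exists_split [NeZero n] {k α : ℕ} (hk2 : 2 ≤ k) (hkn : k < n) (hα : 0 < α)
    {x : ZMod n → ℝ} (hx : 0 ≤ x) (hxα : ∀ u, (α : ℝ) ≤ windowSum k x u)
    (hΓ : ∀ (γ : List (Arc n n)) (p : ℤ),
      IsCircuit (fun i : Fin n => ((i : ℕ) : ZMod n)) (fun _ => k) γ →
      (∀ a ∈ γ, ¬ Arc.IsRevRow a) → (∀ a ∈ γ, ¬ Arc.IsFwdShort a) →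
      p * (n : ℤ) = windingSum (fun _ : Fin n => k) γ →
      GammaIneqHolds (fun i : Fin n => ((i : ℕ) : ZMod n)) (fun _ => k)
        (fun _ => (α : ℤ)) γ p x)
    {β : ℤ} (hβ : β < ∑ j, x j) (hβ' : ∑ j, x j < β + 1) {μ : ℝ} (hμ : μ = β + 1 - ∑ j, x j) :
    ∃ y : ZMod n → ℝ, 0 ≤ y ∧ y ≤ x ∧ (∀ u, μ * α ≤ windowSum k y u) ∧
      (∀ u, (1 - μ) * α ≤ windowSum k (x - y) u) ∧ ∑ j, y j ≤ μ * β := by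
  have hμ0 : 0 < μ := by linarith
  have hμ1 : μ < 1 := by linarith
  have hα' : (0 : ℝ) < α := by exact_mod_cast hα
  have h1 : (1 : ZMod n) ≠ 0 := by
    have : Fact (1 < n) := ⟨by omega⟩
    exact one_ne_zero
  have hk : (k : ZMod n) ≠ 0 := fun h =>
    absurd (Nat.le_of_dvd (by omega) ((ZMod.natCast_eq_zero_iff k n).1 h)) (by omega)
  have hSpos : 0 < ∑ j, x j := hα'.trans_le ((hxα 0).trans (windowSum_le_sum hkn.le hx 0))
  have hμx : μ • x ∈ lowerCovers k (μ * α) x :=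
    ⟨fun j => mul_le_of_le_one_left (hx j) hμ1.le, fun u => by
      rw [windowSum_smul]
      exact mul_le_mul_of_nonneg_left (hxα u) hμ0.le⟩
  obtain ⟨y₀, hy₀, hmin⟩ := (isCompact_lowerCovers (by omega) (μ * α) hx).exists_isMinOn
    ⟨_, hμx⟩ (f := fun y => ∑ j, y j) (by fun_prop)
  have hmin : ∀ y ∈ lowerCovers k (μ * α) x, ∑ j, y₀ j ≤ ∑ j, y j := hmin
  obtain ⟨y₁, hy₁, hsum₁, γ, p, hγ, hrow, hshort, hp, hslack⟩ := exists_tight_circuit h1 hk hy₀ hmin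
  have hchain := hγ.1.2.1
  have hslack₁ : (γ.map (arcSlack k (μ * α) x y₁)).sum = 0 :=
    List.sum_eq_zero fun r hr => by
      obtain ⟨a, ha, rfl⟩ := List.mem_map.1 hr
      exact hslack a ha
  have hlower := sum_arcSlack_self_nonneg hxα γ
  have hgamma := (gammaIneqHolds_iff k α p hrow x).1 (hΓ γ p hγ hrow hshort hp)
  have hP : 0 ≤ ∑ j, (pMinus (fun i : Fin n => ((i : ℕ) : ZMod n)) (fun _ => k) γ j : ℝ) * x j :=
    sum_nonneg fun j _ => mul_nonneg (by positivity) (hx j)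
  have hslackθ : ∀ y, ∑ j, y j = ∑ j, y₀ j → (γ.map (arcSlack k (μ * α) x y)).sum = 0 := by
    intro y hy
    rw [← hslack₁, sum_arcSlack _ x y hchain hrow hshort hp,
      sum_arcSlack _ x y₁ hchain hrow hshort hp, hy, hsum₁]
  rw [sum_arcSlack _ x y₁ hchain hrow hshort hp, hsum₁] at hslack₁
  rw [sum_arcSlack _ x x hchain hrow hshort hp] at hlower
  generalize ∑ j, (pMinus (fun i : Fin n => ((i : ℕ) : ZMod n)) (fun _ => k) γ j : ℝ) * x j = P at *
  have hθS : ∑ j, y₀ j < ∑ j, x j := by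
    have := hmin _ hμx
    simp only [Pi.smul_apply, smul_eq_mul, ← mul_sum] at this
    nlinarith
  have hN : (0 : ℝ) ≤ α * numRowArcs γ := by positivity
  have hpθ : (1 - μ) * (α * numRowArcs γ) ≤ p * (∑ j, x j - ∑ j, y₀ j) := by
    nlinarith
  have hp0 : 0 < p := by
    have hp' : 0 ≤ p := by
      by_contra! hneg
      have : (p : ℝ) < 0 := by exact_mod_cast hneg
      nlinarith
    refine lt_of_le_of_ne hp' fun h => ?_
    subst h
    have hN0 : numRowArcs γ = 0 := by
      by_contra hne
      have : (0 : ℝ) < numRowArcs γ := by exact_mod_cast Nat.pos_of_ne_zero hne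
      have : 0 < (1 - μ) * (α * numRowArcs γ) := mul_pos (by linarith) (mul_pos hα' this)
      push_cast at hpθ
      linarith
    rw [windingSum_const k hrow hshort, hN0] at hp
    have := List.length_pos_of_ne_nil hγ.1.1
    push_cast at hp
    omega
  have hθ : ∑ j, y₀ j ≤ μ * β := by
    have hb := mul_sub_le_of_gamma_bound hp0 hβ hβ' hP (by push_cast; linarith) hgamma
    have : (0 : ℝ) < p := by exact_mod_cast hp0
    rw [← hμ] at hb
    push_cast at hb
    by_contra! hlt
    nlinarith
  obtain ⟨v, hv⟩ : ∃ v, ∀ y ∈ lowerCovers k (μ * α) x, ∑ j, y j = ∑ j, y₀ j →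
      y v = x v ∨ windowSum k y (v + 1) = μ * α := by
    have hfirst : ∀ a ∈ γ, ∀ y ∈ lowerCovers k (μ * α) x, ∑ j, y j = ∑ j, y₀ j →
        arcSlack k (μ * α) x y a = 0 := by
      intro a ha y hy hsum
      refine le_antisymm ?_ (arcSlack_nonneg hy a)
      rw [← hslackθ y hsum]
      refine List.single_le_sum (fun r hr => ?_) _ (List.mem_map_of_mem ha)
      obtain ⟨b, -, rfl⟩ := List.mem_map.1 hr
      exact arcSlack_nonneg hy b
    obtain ⟨a, ha⟩ := List.exists_mem_of_ne_nil γ hγ.1.1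
    cases a with
    | fwdRow i =>
      refine ⟨((i : ℕ) : ZMod n) - 1, fun y hy hsum => Or.inr ?_⟩
      rw [sub_add_cancel]
      exact sub_eq_zero.1 (hfirst _ ha y hy hsum)
    | fwdShort j => exact absurd trivial (hshort _ ha)
    | revRow i => exact absurd trivial (hrow _ ha)
    | revShort j =>
      exact ⟨j, fun y hy hsum => Or.inl (sub_eq_zero.1 (hfirst _ ha y hy hsum)).symm⟩
  obtain ⟨y, hy, hsum, htight⟩ := exists_forall_tight h1 hk hx ⟨y₀, hy₀, rfl⟩ hv
  by_cases hper : k * ∑ j, y j = n * (μ * α)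
  · obtain ⟨z, hz0, hzx, hz⟩ := exists_nonneg_windowSum_eq (mul_pos hμ0 hα') hx hy hper
    refine ⟨z, hz0, hzx, fun u => (hz u).ge, fun u => ?_, ?_⟩
    · rw [windowSum_sub, hz]
      linarith [hxα u]
    · have hzsum := sum_windowSum k z
      simp only [hz, sum_const, card_univ, ZMod.card, nsmul_eq_mul] at hzsum
      rw [← hper] at hzsum
      have hk0 : (k : ℝ) ≠ 0 := by
        have : k ≠ 0 := by omega
        exact_mod_cast this
      rw [← mul_left_cancel₀ hk0 hzsum, hsum]
      exact hθ
  · refine ⟨y, nonneg_of_tight hx hy.2 hper htight, hy.1, hy.2,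
      le_windowSum_sub_of_tight hy.1 ?_ (fun u => ?_) htight, hsum.trans_le hθ⟩
    · rintro rfl
      exact hθS.ne hsum.symm
    · linarith [hxα u]

/-- A point of `Q(Cₙᵏ, α·1)` satisfying the `Γ`-inequalities is in `Q*(Cₙᵏ, α·1)`. -/
lemma mem_Qstar_of_gammaIneqHolds [NeZero n] {k α : ℕ} (hk2 : 2 ≤ k) (hkn : k < n)
    {x : ZMod n → ℝ} (hx : 0 ≤ x) (hxα : ∀ u, (α : ℝ) ≤ windowSum k x u)
    (hΓ : ∀ (γ : List (Arc n n)) (p : ℤ),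
      IsCircuit (fun i : Fin n => ((i : ℕ) : ZMod n)) (fun _ => k) γ →
      (∀ a ∈ γ, ¬ Arc.IsRevRow a) → (∀ a ∈ γ, ¬ Arc.IsFwdShort a) →
      p * (n : ℤ) = windingSum (fun _ : Fin n => k) γ →
      GammaIneqHolds (fun i : Fin n => ((i : ℕ) : ZMod n)) (fun _ => k)
        (fun _ => (α : ℤ)) γ p x) :
    x ∈ Qstar (circMatrix (fun i : Fin n => ((i : ℕ) : ZMod n)) (fun _ => k))
      (fun _ => (α : ℝ)) := by
  rcases (Int.floor_le (∑ j, x j)).eq_or_lt with hint | hβ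
  · exact mem_Qstar_of_sum_int hkn.le hx hxα hint.symm
  have hβ' := Int.lt_floor_add_one (∑ j, x j)
  set β := ⌊∑ j, x j⌋
  obtain ⟨μ, hμ⟩ : ∃ μ : ℝ, μ = β + 1 - ∑ j, x j := ⟨_, rfl⟩
  have hμ0 : 0 < μ := by linarith
  have hμ1 : 0 < 1 - μ := by linarith
  have hβ0 : (0 : ℝ) ≤ β := by
    have : 0 ≤ β := Int.floor_nonneg.2 (sum_nonneg fun j _ => hx j)
    exact_mod_cast this
  obtain ⟨y, hy0, hyx, hyα, hxy, hsum⟩ : ∃ y : ZMod n → ℝ, 0 ≤ y ∧ y ≤ x ∧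
      (∀ u, μ * α ≤ windowSum k y u) ∧ (∀ u, (1 - μ) * α ≤ windowSum k (x - y) u) ∧
      ∑ j, y j ≤ μ * β := by
    rcases Nat.eq_zero_or_pos α with rfl | hα
    · refine ⟨0, le_rfl, hx, fun u => by simp [windowSum], fun u => ?_, ?_⟩
      · simpa using windowSum_nonneg k hx u
      · simpa using mul_nonneg hμ0.le hβ0
    · exact exists_split hk2 hkn hα hx hxα hΓ hβ hβ' hμ
  let C : Set (ZMod n → ℝ) := {y | 0 ≤ y ∧ y ≤ x ∧ (∀ u, μ * α ≤ windowSum k y u) ∧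
    ∀ u, (1 - μ) * α ≤ windowSum k (x - y) u}
  obtain ⟨z, ⟨hz0, hzx, hzα, hxz⟩, hzsum⟩ : ∃ z ∈ C, ∑ j, z j = μ * β := by
    have hCconv : Convex ℝ C := by
      rintro y ⟨ha, hb, hc, hd⟩ z ⟨ha', hb', hc', hd'⟩ s t hs ht hst
      simp only [windowSum_sub] at hd hd'
      refine ⟨add_nonneg (smul_nonneg hs ha) (smul_nonneg ht ha'), fun j => ?_, fun u => ?_,
        fun u => ?_⟩
      · have h1 := mul_le_mul_of_nonneg_left (hb j) hs
        have h2 := mul_le_mul_of_nonneg_left (hb' j) ht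
        have h3 : s * x j + t * x j = x j := by rw [← add_mul, hst, one_mul]
        simp only [Pi.add_apply, Pi.smul_apply, smul_eq_mul]
        linarith
      · have h1 := mul_le_mul_of_nonneg_left (hc u) hs
        have h2 := mul_le_mul_of_nonneg_left (hc' u) ht
        have h3 : s * (μ * α) + t * (μ * α) = μ * α := by rw [← add_mul, hst, one_mul]
        rw [windowSum_add, windowSum_smul, windowSum_smul]
        linarith
      · have h1 := mul_le_mul_of_nonneg_left (hd u) hs
        have h2 := mul_le_mul_of_nonneg_left (hd' u) ht
        have h3 : s * ((1 - μ) * α) + t * ((1 - μ) * α) = (1 - μ) * α := by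
          rw [← add_mul, hst, one_mul]
        have h4 : s * windowSum k x u + t * windowSum k x u = windowSum k x u := by
          rw [← add_mul, hst, one_mul]
        rw [windowSum_sub, windowSum_add, windowSum_smul, windowSum_smul]
        linarith
    have hyC : y ∈ C := ⟨hy0, hyx, hyα, hxy⟩
    have hxC : μ • x ∈ C := by
      refine ⟨smul_nonneg hμ0.le hx, fun j => mul_le_of_le_one_left (hx j) (by linarith),
        fun u => ?_, fun u => ?_⟩
      · rw [windowSum_smul]
        exact mul_le_mul_of_nonneg_left (hxα u) hμ0.le
      · rw [windowSum_sub, windowSum_smul]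
        nlinarith [mul_le_mul_of_nonneg_left (hxα u) hμ1.le]
    have himg := hCconv.isPreconnected.intermediate_value hyC hxC
      (f := fun y => ∑ j, y j) (by fun_prop)
    refine himg ⟨hsum, ?_⟩
    simp only [Pi.smul_apply, smul_eq_mul, ← mul_sum]
    exact mul_le_mul_of_nonneg_left hβ.le hμ0.le
  have h1 : μ⁻¹ • z ∈ Qstar (circMatrix (fun i : Fin n => ((i : ℕ) : ZMod n)) (fun _ => k))
      (fun _ => (α : ℝ)) := by
    refine mem_Qstar_of_sum_int (S := β) hkn.le (smul_nonneg (by positivity) hz0) (fun u => ?_) ?_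
    · rw [windowSum_smul, inv_mul_eq_div, le_div_iff₀' hμ0]
      exact hzα u
    · simp only [Pi.smul_apply, smul_eq_mul, ← mul_sum, hzsum]
      field_simp
  have h2 : (1 - μ)⁻¹ • (x - z) ∈
      Qstar (circMatrix (fun i : Fin n => ((i : ℕ) : ZMod n)) (fun _ => k))
      (fun _ => (α : ℝ)) := by
    refine mem_Qstar_of_sum_int (S := β + 1) hkn.le
      (smul_nonneg (by positivity) (sub_nonneg.2 hzx)) (fun u => ?_) ?_
    · rw [windowSum_smul, inv_mul_eq_div, le_div_iff₀' hμ1]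
      exact hxz u
    · simp only [Pi.smul_apply, Pi.sub_apply, smul_eq_mul, ← mul_sum, sum_sub_distrib, hzsum]
      rw [inv_mul_eq_div, div_eq_iff hμ1.ne']
      push_cast
      rw [hμ]
      ring
  have := (convex_convexHull ℝ _ : Convex ℝ (Qstar _ _)) h1 h2 hμ0.le hμ1.le (by ring)
  rwa [smul_inv_smul₀ hμ0.ne', smul_inv_smul₀ hμ1.ne', add_sub_cancel] at this

lemma Qstar_subset_Qpoly [NeZero n] (A : Matrix (Fin m) (ZMod n) ℝ) (b : Fin m → ℝ) :
    Qstar A b ⊆ Qpoly A b := by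
  refine convexHull_min (fun x hx => hx.2) ?_
  rintro x ⟨hx0, hx⟩ y ⟨hy0, hy⟩ s t hs ht hst
  refine ⟨fun j => add_nonneg (mul_nonneg hs (hx0 j)) (mul_nonneg ht (hy0 j)), fun i => ?_⟩
  have := add_le_add (mul_le_mul_of_nonneg_left (hx i) hs) (mul_le_mul_of_nonneg_left (hy i) ht)
  rw [← add_mul, hst, one_mul, mul_sum, mul_sum, ← sum_add_distrib] at this
  refine this.trans_eq (sum_congr rfl fun j _ => ?_)
  simp only [Pi.add_apply, Pi.smul_apply, smul_eq_mul]
  ring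

/-- For `2 ≤ k ≤ n - 2` and `α ∈ ℕ`, `Q*(Cₙᵏ, α·1)` is completely
described by `x ≥ 0`, `Cₙᵏ x ≥ α·1`, the rank constraint `∑ⱼ xⱼ ≥ τ_{α·1}(Cₙᵏ)`, and
the `Γ`-inequalities over all simple directed circuits `Γ` in `F(Cₙᵏ)` containing no
forward short arcs. -/
theorem circulant_homogeneous_description (n kk : ℕ) [NeZero n]
    (hk2 : 2 ≤ kk) (hkn : kk ≤ n - 2) (α : ℕ) :
    Qstar (circMatrix (fun i : Fin n => ((i : ℕ) : ZMod n)) (fun _ => kk))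
        (fun _ => (α : ℝ)) =
      {x | x ∈ Qpoly (circMatrix (fun i : Fin n => ((i : ℕ) : ZMod n)) (fun _ => kk))
            (fun _ => (α : ℝ)) ∧
        sInf ((fun y => ∑ j : ZMod n, y j) ''
            Qstar (circMatrix (fun i : Fin n => ((i : ℕ) : ZMod n)) (fun _ => kk))
              (fun _ => (α : ℝ))) ≤ ∑ j : ZMod n, x j ∧
        ∀ (γ : List (Arc n n)) (p : ℤ),
          IsCircuit (fun i : Fin n => ((i : ℕ) : ZMod n)) (fun _ => kk) γ →
          (∀ a ∈ γ, ¬ Arc.IsRevRow a) → (∀ a ∈ γ, ¬ Arc.IsFwdShort a) →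
          p * (n : ℤ) = windingSum (fun _ : Fin n => kk) γ →
          GammaIneqHolds (fun i : Fin n => ((i : ℕ) : ZMod n)) (fun _ => kk)
            (fun _ => (α : ℤ)) γ p x} := by
  have hk : kk ≤ n := by omega
  ext x
  constructor
  · intro hx
    refine ⟨Qstar_subset_Qpoly _ _ hx, csInf_le ⟨0, ?_⟩ ⟨x, hx, rfl⟩, ?_⟩
    · rintro _ ⟨y, hy, rfl⟩
      exact sum_nonneg fun j _ => (Qstar_subset_Qpoly _ _ hy).1 j
    · intro γ p hγ hrow hshort hp
      refine convexHull_min ?_ (convex_setOf_gammaIneqHolds _ _ _ γ p) hx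
      rintro y ⟨hint, hy⟩
      obtain ⟨hy0, hyα⟩ := (mem_Qpoly_iff hk _ _).1 hy
      exact gammaIneqHolds_of_isIntegerPoint hint hy0 hyα hγ hrow hshort hp
  · rintro ⟨hx, -, hΓ⟩
    obtain ⟨hx0, hxα⟩ := (mem_Qpoly_iff hk _ _).1 hx
    exact mem_Qstar_of_gammaIneqHolds hk2 (by omega) hx0 hxα hΓ

end CircCover
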